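/- Let X be a probabilistic coherence space. Then !X is a probabilistic coherence space: besides P(!X)⊥⊥ = P(!X), for every finite multiset m over |X| there exists U ∈ P(!X) with U_m > 0, and for every finite multiset m over |X| there exists A > 0 such that U_m ≤ A for all U ∈ P(!X). -/

import Mathlib

open scoped ENNReal NNReal Classical

noncomputable section

namespace PCS

variable {I J K : Type*}

/-- Pairing `⟨u,u'⟩ = Σ_a u_a u'_a`, valued in `[0,∞]`. -/
def pair (u u' : I → ℝ≥0) : ℝ≥0∞ := ∑' a, (u a : ℝ≥0∞) * (u' a : ℝ≥0∞)

/-- Orthogonal of a set of nonnegative families. -/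
def orth (F : Set (I → ℝ≥0)) : Set (I → ℝ≥0) := {u' | ∀ u ∈ F, pair u u' ≤ 1}

/-- `P` is (the set of vectors of) a probabilistic coherence space on the web `I`. -/
structure IsPCS (P : Set (I → ℝ≥0)) : Prop where
  biorth : orth (orth P) = P
  pos : ∀ a : I, ∃ u ∈ P, 0 < u a
  bdd : ∀ a : I, ∃ A : ℝ≥0, 0 < A ∧ ∀ u ∈ P, u a ≤ A

/-- Application of a matrix to a vector: `(t·u)_b = Σ_a t_{a,b} u_a ∈ [0,∞]`. -/
def matApp (t : I × J → ℝ≥0) (u : I → ℝ≥0) : J → ℝ≥0∞ :=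
  fun b => ∑' a, (t (a, b) : ℝ≥0∞) * (u a : ℝ≥0∞)

/-- Application for `[0,∞]`-valued matrices/vectors. -/
def matAppE (t : I × J → ℝ≥0∞) (u : I → ℝ≥0∞) : J → ℝ≥0∞ :=
  fun b => ∑' a, t (a, b) * u a

/-- A `[0,∞]`-valued vector belongs to `Q ⊆ (ℝ≥0)^J` if it is pointwise the coercion of
an element of `Q` (in particular it is everywhere finite). -/
def memP (Q : Set (J → ℝ≥0)) (v : J → ℝ≥0∞) : Prop :=
  ∃ w ∈ Q, ∀ b, v b = (w b : ℝ≥0∞)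

/-- `t` is a morphism from `(I,P)` to `(J,Q)`: `t·u ∈ Q` for every `u ∈ P`. -/
def IsMorphism (t : I × J → ℝ≥0) (P : Set (I → ℝ≥0)) (Q : Set (J → ℝ≥0)) : Prop :=
  ∀ u ∈ P, memP Q (matApp t u)

/-- Matrix composition `(t ∘ s)_{a,c} = Σ_b s_{a,b} t_{b,c}`, in `[0,∞]`. -/
def matComp (s : I × J → ℝ≥0) (t : J × K → ℝ≥0) : I × K → ℝ≥0∞ :=
  fun p => ∑' b, (s (p.1, b) : ℝ≥0∞) * (t (b, p.2) : ℝ≥0∞)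

/-- Composition of `[0,∞]`-valued matrices. -/
def matCompE (s : I × J → ℝ≥0∞) (t : J × K → ℝ≥0∞) : I × K → ℝ≥0∞ :=
  fun p => ∑' b, s (p.1, b) * t (b, p.2)

/-- Set of simple tensors `u⊗v` with `u ∈ P`, `v ∈ Q`. -/
def tensSet (P : Set (I → ℝ≥0)) (Q : Set (J → ℝ≥0)) : Set (I × J → ℝ≥0) :=
  {w | ∃ u ∈ P, ∃ v ∈ Q, w = fun p => u p.1 * v p.2}

/-- `P(X⊗Y)`: biorthogonal closure of the simple tensors. -/
def tensorP (P : Set (I → ℝ≥0)) (Q : Set (J → ℝ≥0)) : Set (I × J → ℝ≥0) :=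
  orth (orth (tensSet P Q))

/-- `P(X⊸Y) = P((X ⊗ Y⊥)⊥)`. -/
def limplP (P : Set (I → ℝ≥0)) (Q : Set (J → ℝ≥0)) : Set (I × J → ℝ≥0) :=
  orth (tensorP P (orth Q))

/-- Norm `‖u‖_X = sup{⟨u,u'⟩ : u' ∈ P(X)⊥}`. -/
def normE (P : Set (I → ℝ≥0)) (u : I → ℝ≥0) : ℝ≥0∞ :=
  ⨆ u' ∈ orth P, pair u u'

/-- The product `&_{i} X_i`. -/
def withP {ι : Type*} {A : ι → Type*} (P : ∀ i, Set (A i → ℝ≥0)) :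
    Set ((Σ i, A i) → ℝ≥0) :=
  {u | ∀ i, (fun a => u ⟨i, a⟩) ∈ P i}

/-- The coproduct `⊕_{i} X_i = (&_{i} X_i⊥)⊥`. -/
def plusP {ι : Type*} {A : ι → Type*} (P : ∀ i, Set (A i → ℝ≥0)) :
    Set ((Σ i, A i) → ℝ≥0) :=
  orth (withP fun i => orth (P i))

/-- Projection matrix `π_i`. -/
def projMat {ι : Type*} {A : ι → Type*} (i : ι) : ((Σ j, A j) × A i) → ℝ≥0 :=
  fun p => if p.1 = ⟨i, p.2⟩ then 1 else 0

/-- Injection matrix `in_j`. -/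
def injMat {ι : Type*} {A : ι → Type*} (j : ι) : (A j × Σ i, A i) → ℝ≥0 :=
  fun p => if p.2 = ⟨j, p.1⟩ then 1 else 0

/-- `u^m = Π_a u_a^{m(a)}`. -/
def mpow (u : I → ℝ≥0) (m : Multiset I) : ℝ≥0 := (m.map u).prod

/-- `v^m` for `[0,∞]`-valued `v`. -/
def mpowE (v : I → ℝ≥0∞) (m : Multiset I) : ℝ≥0∞ := (m.map v).prod

/-- Promotion `u^! = (u^m)_m`. -/
def promote (u : I → ℝ≥0) : Multiset I → ℝ≥0 := fun m => mpow u m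

/-- `P(!X)`: biorthogonal closure of the promotions. -/
def bangP (P : Set (I → ℝ≥0)) : Set (Multiset I → ℝ≥0) :=
  orth (orth {v | ∃ u ∈ P, v = promote u})

/-- The function associated with a matrix `s ∈ (ℝ≥0)^{Mfin(I)×J}`:
`ŝ(u)_b = Σ_m s_{m,b} u^m`. -/
def fhat (s : Multiset I × J → ℝ≥0) (u : I → ℝ≥0) : J → ℝ≥0∞ :=
  fun b => ∑' m : Multiset I, (s (m, b) : ℝ≥0∞) * (mpow u m : ℝ≥0∞)

/-- Factorial of a multiset: `m! = Π_a m(a)!`. -/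
def mfact [DecidableEq I] (m : Multiset I) : ℕ :=
  (m.dedup.map fun a => (m.count a).factorial).prod

/-- Multisets over `I × J` with first marginal `c` and second marginal `d`. -/
def marg (c : Multiset I) (d : Multiset J) : Set (Multiset (I × J)) :=
  {r | r.map Prod.fst = c ∧ r.map Prod.snd = d}

/-- The exponential of a matrix: `(!t)_{c,d} = Σ_{r ∈ L(c,d)} (d!/r!) t^r`. -/
def bangMatE [DecidableEq I] [DecidableEq J] (t : I × J → ℝ≥0∞) :
    Multiset I × Multiset J → ℝ≥0∞ :=
  fun p => ∑' r : marg p.1 p.2,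
    ((mfact p.2 : ℝ≥0∞) / (mfact r.1 : ℝ≥0∞)) * mpowE t r.1

theorem pair_comm (u v : I → ℝ≥0) : pair u v = pair v u := by
  simp only [pair, mul_comm]

theorem pair_zero_right (u : I → ℝ≥0) : pair u 0 = 0 := by
  simp [pair]

theorem pair_add_right (u v w : I → ℝ≥0) : pair u (v + w) = pair u v + pair u w := by
  simp only [pair, Pi.add_apply, ENNReal.coe_add, mul_add, ENNReal.tsum_add]

theorem pair_smul_right (c : ℝ≥0) (u v : I → ℝ≥0) : pair u (c • v) = c * pair u v := by
  simp only [pair, Pi.smul_apply, smul_eq_mul, ENNReal.coe_mul, mul_left_comm, ENNReal.tsum_mul_left]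

theorem pair_single_right (u : I → ℝ≥0) (a : I) (c : ℝ≥0) :
    pair u (Pi.single a c) = (u a * c : ℝ≥0) := by
  rw [pair, tsum_eq_single a fun b hb => by simp [Pi.single_eq_of_ne hb]]
  simp

theorem orth_antitone {F G : Set (I → ℝ≥0)} (h : F ⊆ G) : orth G ⊆ orth F :=
  fun _ hv u hu => hv u (h hu)

theorem subset_orth_orth (F : Set (I → ℝ≥0)) : F ⊆ orth (orth F) :=
  fun u hu v hv => pair_comm v u ▸ hv u hu

theorem orth_orth_orth (F : Set (I → ℝ≥0)) : orth (orth (orth F)) = orth F :=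
  (orth_antitone (subset_orth_orth F)).antisymm (subset_orth_orth (orth F))

theorem zero_mem_orth (F : Set (I → ℝ≥0)) : 0 ∈ orth F :=
  fun u _ => by simp [pair_zero_right]

theorem midpoint_mem_orth {F : Set (I → ℝ≥0)} {v w : I → ℝ≥0} (hv : v ∈ orth F)
    (hw : w ∈ orth F) : (2⁻¹ : ℝ≥0) • (v + w) ∈ orth F := fun u hu => by
  rw [pair_smul_right, pair_add_right, ENNReal.coe_inv two_ne_zero, ENNReal.coe_ofNat]
  calc (2⁻¹ : ℝ≥0∞) * (pair u v + pair u w) ≤ 2⁻¹ * (1 + 1) := by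
        gcongr
        exacts [hv u hu, hw u hu]
    _ = 1 := by rw [one_add_one_eq_two, ENNReal.inv_mul_cancel two_ne_zero ENNReal.ofNat_ne_top]

theorem IsPCS.exists_pos_on {P : Set (I → ℝ≥0)} (hP : IsPCS P) (m : Multiset I) :
    ∃ u ∈ P, ∀ a ∈ m, 0 < u a := by
  induction m using Multiset.induction_on with
  | empty => exact ⟨0, hP.biorth ▸ zero_mem_orth _, by simp⟩
  | cons a m ih =>
    obtain ⟨u, hu, hpos⟩ := ih
    obtain ⟨v, hv, hva⟩ := hP.pos a
    rw [← hP.biorth] at hu hv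
    refine ⟨_, hP.biorth.subset (midpoint_mem_orth hv hu), fun b hb => ?_⟩
    simp only [Pi.smul_apply, Pi.add_apply, smul_eq_mul]
    rcases Multiset.mem_cons.1 hb with rfl | hb
    · positivity
    · have := hpos b hb
      positivity

theorem mpow_pos {u : I → ℝ≥0} {m : Multiset I} (h : ∀ a ∈ m, 0 < u a) : 0 < mpow u m := by
  rw [pos_iff_ne_zero, mpow, Ne, Multiset.prod_eq_zero_iff, Multiset.mem_map]
  rintro ⟨a, ha, h0⟩
  exact (h a ha).ne' h0

theorem IsPCS.exists_mpow_le {P : Set (I → ℝ≥0)} (hP : IsPCS P) (m : Multiset I) :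
    ∃ A : ℝ≥0, 0 < A ∧ ∀ u ∈ P, mpow u m ≤ A := by
  choose A hA hbdd using hP.bdd
  exact ⟨mpow A m, mpow_pos fun a _ => hA a,
    fun u hu => Multiset.prod_map_le_prod_map _ _ fun a _ => hbdd a u hu⟩

/-- A uniform bound on one coordinate of `F` persists in its biorthogonal closure. -/
theorem le_of_mem_orth_orth {F : Set (I → ℝ≥0)} {a : I} {A : ℝ≥0} (hA : 0 < A)
    (hF : ∀ u ∈ F, u a ≤ A) {v : I → ℝ≥0} (hv : v ∈ orth (orth F)) : v a ≤ A := by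
  have key : ∀ u : I → ℝ≥0, pair u (Pi.single a A⁻¹) ≤ 1 ↔ u a ≤ A := fun u => by
    rw [pair_single_right, ENNReal.coe_le_one_iff, mul_inv_le_iff₀ hA, one_mul]
  rw [← key, pair_comm]
  exact hv _ fun u hu => (key u).2 (hF u hu)

/-- `!X` is a probabilistic coherence space. -/
theorem bang_pcs {I : Type*} [Countable I] (P : Set (I → ℝ≥0)) (hP : IsPCS P) :
    IsPCS (bangP P) where
  biorth := orth_orth_orth _
  pos m := by
    obtain ⟨u, hu, hpos⟩ := hP.exists_pos_on m
    exact ⟨promote u, subset_orth_orth _ ⟨u, hu, rfl⟩, mpow_pos hpos⟩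
  bdd m := by
    obtain ⟨A, hA, hbdd⟩ := hP.exists_mpow_le m
    refine ⟨A, hA, fun U hU => le_of_mem_orth_orth hA ?_ hU⟩
    rintro _ ⟨u, hu, rfl⟩
    exact hbdd u hu

end PCS
end
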